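/- arXiv:2007.15924 — 6 statements merged into one kernel-verified Lean document; each statement's English description precedes it below -/
import Mathlib

section
/- Let σ > 0 and let ε be a real number with 0 < ε ≤ 2. If x ∈ ℝ satisfies x ≥ σ·(1 + √(ln(2/ε))), then (x/σ)·exp(−x²/σ²) ≤ ε/2. -/
/-- Tail bound for the weighting function: if
`x ≥ σ·(1 + √(ln(2/ε)))` with `0 < ε ≤ 2`, then `f_σ(x) ≤ ε/2`. -/
theorem weight_tail_bound (σ : ℝ) (hσ : 0 < σ) (ε : ℝ) (hε : 0 < ε) (hε2 : ε ≤ 2)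
    (x : ℝ) (hx : σ * (1 + Real.sqrt (Real.log (2 / ε))) ≤ x) :
    (x / σ) * Real.exp (-(x ^ 2) / σ ^ 2) ≤ ε / 2 := by
  have hlog : 0 ≤ Real.log (2 / ε) := Real.log_nonneg ((one_le_div hε).2 hε2)
  have hsq := Real.sq_sqrt hlog
  have hs := Real.sqrt_nonneg (Real.log (2 / ε))
  have ht : 1 + Real.sqrt (Real.log (2 / ε)) ≤ x / σ := (le_div_iff₀' hσ).2 hx
  have hexp : Real.exp (-Real.log (2 / ε)) = ε / 2 := by
    rw [Real.exp_neg, Real.exp_log (by positivity), inv_div]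
  rw [neg_div, ← div_pow, ← hexp]
  generalize x / σ = t at *
  calc t * Real.exp (-t ^ 2) ≤ Real.exp (t - 1) * Real.exp (-t ^ 2) := by
        gcongr
        linarith [Real.add_one_le_exp (t - 1)]
    _ = Real.exp (t - 1 - t ^ 2) := by rw [← Real.exp_add, sub_eq_add_neg _ (t ^ 2)]
    _ ≤ Real.exp (-Real.log (2 / ε)) := Real.exp_le_exp.2 (by nlinarith)
end

section
/- Let σ > 0, define f_σ : ℝ → ℝ by f_σ(x) = (x/σ)·exp(−x²/σ²), let S be a nonempty subset of ℝ², and let q₁, q₂ ∈ ℝ². Then |f_σ(d(q₁, S)) − f_σ(d(q₂, S))| ≤ (1/σ)·‖q₁ − q₂‖, where d(q, S) = inf_{p ∈ S} ‖q − p‖. -/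
theorem abs_one_sub_two_mul_mul_exp_neg_le_one {u : ℝ} (hu : 0 ≤ u) :
    |(1 - 2 * u) * Real.exp (-u)| ≤ 1 := by
  have hexp := Real.quadratic_le_exp_of_nonneg hu
  rw [Real.exp_neg, ← div_eq_mul_inv, abs_div, Real.abs_exp, div_le_one (Real.exp_pos u), abs_le]
  constructor <;> nlinarith [sq_nonneg (u - 1)]

theorem hasDerivAt_mul_exp_neg_sq (t : ℝ) :
    HasDerivAt (fun x : ℝ => x * Real.exp (-x ^ 2)) ((1 - 2 * t ^ 2) * Real.exp (-t ^ 2)) t := by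
  refine ((hasDerivAt_id' t).mul (hasDerivAt_pow 2 t).fun_neg.exp).congr_deriv ?_
  push_cast
  ring

theorem abs_mul_exp_neg_sq_sub_le (x y : ℝ) :
    |x * Real.exp (-x ^ 2) - y * Real.exp (-y ^ 2)| ≤ |x - y| := by
  simpa using convex_univ.norm_image_sub_le_of_norm_hasDerivWithin_le
    (fun t _ => (hasDerivAt_mul_exp_neg_sq t).hasDerivWithinAt)
    (fun t _ => abs_one_sub_two_mul_mul_exp_neg_le_one (sq_nonneg t))
    (Set.mem_univ y) (Set.mem_univ x)

open Metric in
/-- The composition of the weighting function `f_σ` with the minDist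
function to a fixed nonempty set `S` is Lipschitz in the landmark with constant `1/σ`. -/
theorem weight_infDist_lipschitz
    (σ : ℝ) (hσ : 0 < σ)
    (S : Set (EuclideanSpace ℝ (Fin 2))) (hS : S.Nonempty)
    (q₁ q₂ : EuclideanSpace ℝ (Fin 2)) :
    |(infDist q₁ S / σ) * Real.exp (-(infDist q₁ S ^ 2) / σ ^ 2)
      - (infDist q₂ S / σ) * Real.exp (-(infDist q₂ S ^ 2) / σ ^ 2)|
      ≤ (1 / σ) * ‖q₁ - q₂‖ := by
  have hdist : |infDist q₁ S - infDist q₂ S| ≤ ‖q₁ - q₂‖ := by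
    simpa [Real.dist_eq, dist_eq_norm] using (lipschitz_infDist_pt S).dist_le_mul q₁ q₂
  have hweight := abs_mul_exp_neg_sq_sub_le (infDist q₁ S / σ) (infDist q₂ S / σ)
  rw [← sub_div, abs_div, abs_of_pos hσ, div_pow, div_pow, ← neg_div, ← neg_div] at hweight
  calc
    _ ≤ |infDist q₁ S - infDist q₂ S| / σ := hweight
    _ ≤ ‖q₁ - q₂‖ / σ := by gcongr
    _ = 1 / σ * ‖q₁ - q₂‖ := by ring
end

section
/- Let σ > 0, define f_σ : ℝ → ℝ by f_σ(x) = (x/σ)·exp(−x²/σ²), let S be a nonempty subset of ℝ², and let q₁, q₂ ∈ ℝ². If some point p ∈ S lies on the closed line segment joining q₁ and q₂, then f_σ(d(q₁, S)) + f_σ(d(q₂, S)) ≤ (1/σ)·‖q₁ − q₂‖, where d(q, S) = inf_{p ∈ S} ‖q − p‖. -/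
/-- The Gaussian-damped weight `x / σ * exp (-x² / σ²)` is at most `x / σ` for `x ≥ 0`. -/
lemma div_mul_exp_neg_sq_le {σ x : ℝ} (hσ : 0 < σ) (hx : 0 ≤ x) :
    x / σ * Real.exp (-(x ^ 2) / σ ^ 2) ≤ x / σ := by
  refine mul_le_of_le_one_right (by positivity) (Real.exp_le_one_iff.2 ?_)
  exact div_nonpos_of_nonpos_of_nonneg (neg_nonpos.2 (sq_nonneg x)) (sq_nonneg σ)

open Metric in
/-- If a point of `S` lies on the segment joining the landmarks `q₁`
and `q₂`, then the sum of the weighted feature magnitudes is at most `(1/σ)·‖q₁ − q₂‖`. -/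
theorem weight_sum_le_of_mem_segment
    (σ : ℝ) (hσ : 0 < σ)
    (S : Set (EuclideanSpace ℝ (Fin 2))) (hS : S.Nonempty)
    (q₁ q₂ : EuclideanSpace ℝ (Fin 2))
    (p : EuclideanSpace ℝ (Fin 2)) (hpS : p ∈ S) (hpseg : p ∈ segment ℝ q₁ q₂) :
    (infDist q₁ S / σ) * Real.exp (-(infDist q₁ S ^ 2) / σ ^ 2)
      + (infDist q₂ S / σ) * Real.exp (-(infDist q₂ S ^ 2) / σ ^ 2)
      ≤ (1 / σ) * ‖q₁ - q₂‖ := by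
  calc
    _ ≤ infDist q₁ S / σ + infDist q₂ S / σ :=
      add_le_add (div_mul_exp_neg_sq_le hσ infDist_nonneg)
        (div_mul_exp_neg_sq_le hσ infDist_nonneg)
    _ = 1 / σ * (infDist q₁ S + infDist q₂ S) := by ring
    _ ≤ 1 / σ * (dist q₁ p + dist p q₂) := by
      gcongr
      · exact infDist_le_dist_of_mem hpS
      · rw [dist_comm]
        exact infDist_le_dist_of_mem hpS
    _ = 1 / σ * ‖q₁ - q₂‖ := by
      rw [dist_add_dist_of_mem_segment hpseg, dist_eq_norm]
end

section
/- Let σ > 0, define f_σ : ℝ → ℝ by f_σ(x) = (x/σ)·exp(−x²/σ²), let A and B be nonempty subsets of ℝ², let a ∈ A and b ∈ B, and let q be a point on the closed line segment joining a and b. Then f_σ(d(q, A)) + f_σ(d(q, B)) ≤ (1/σ)·‖a − b‖, where d(q, S) = inf_{p ∈ S} ‖q − p‖. -/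
/-- The weight `(x / σ) * exp (-x² / σ²)` is bounded by `y / σ` whenever `0 ≤ x ≤ y`. -/
lemma div_mul_exp_neg_sq_le_div {σ x y : ℝ} (hσ : 0 < σ) (hx : 0 ≤ x) (hxy : x ≤ y) :
    (x / σ) * Real.exp (-(x ^ 2) / σ ^ 2) ≤ y / σ := by
  have hexp : Real.exp (-(x ^ 2) / σ ^ 2) ≤ 1 :=
    Real.exp_le_one_iff.mpr (div_nonpos_of_nonpos_of_nonneg (by nlinarith) (by positivity))
  calc (x / σ) * Real.exp (-(x ^ 2) / σ ^ 2) ≤ x / σ :=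
        mul_le_of_le_one_right (by positivity) hexp
    _ ≤ y / σ := by gcongr

open Metric in
/-- If the landmark `q` lies on the segment joining `a ∈ A` and
`b ∈ B`, then the sum of the weighted feature magnitudes is at most `(1/σ)·‖a − b‖`. -/
theorem weight_sum_le_of_landmark_on_segment
    (σ : ℝ) (hσ : 0 < σ)
    (A B : Set (EuclideanSpace ℝ (Fin 2))) (hA : A.Nonempty) (hB : B.Nonempty)
    (a b : EuclideanSpace ℝ (Fin 2)) (ha : a ∈ A) (hb : b ∈ B)
    (q : EuclideanSpace ℝ (Fin 2)) (hq : q ∈ segment ℝ a b) :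
    (infDist q A / σ) * Real.exp (-(infDist q A ^ 2) / σ ^ 2)
      + (infDist q B / σ) * Real.exp (-(infDist q B ^ 2) / σ ^ 2)
      ≤ (1 / σ) * ‖a - b‖ := by
  have hAq := div_mul_exp_neg_sq_le_div hσ infDist_nonneg (infDist_le_dist_of_mem (x := q) ha)
  have hBq := div_mul_exp_neg_sq_le_div hσ infDist_nonneg (infDist_le_dist_of_mem (x := q) hb)
  calc _ ≤ dist q a / σ + dist q b / σ := add_le_add hAq hBq
    _ = (1 / σ) * ‖a - b‖ := by
        rw [← dist_eq_norm, ← dist_add_dist_of_mem_segment hq, dist_comm q a]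
        ring
end

section
/- Let σ > 0, let r be a real number with 0 < r ≤ 2σ, define f_σ : ℝ → ℝ by f_σ(x) = (x/σ)·exp(−x²/σ²), let A and B be nonempty subsets of ℝ², and let q ∈ ℝ². If d(q, A) ≥ σ·(1 + √(ln(2σ/r))) and d(q, B) ≥ σ·(1 + √(ln(2σ/r))), then f_σ(d(q, A)) + f_σ(d(q, B)) ≤ r/σ, where d(q, S) = inf_{p ∈ S} ‖q − p‖. -/
/-- The Gaussian-weighted identity `y * exp (-y²)` is at most `exp (-s²)` once `y ≥ 1 + s`. -/
lemma mul_exp_neg_sq_le_exp_neg_sq {s y : ℝ} (hs : 0 ≤ s) (hy : 1 + s ≤ y) :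
    y * Real.exp (-y ^ 2) ≤ Real.exp (-s ^ 2) := by
  have hle : y ≤ Real.exp (y - 1) := by linarith [Real.add_one_le_exp (y - 1)]
  calc y * Real.exp (-y ^ 2) ≤ Real.exp (y - 1) * Real.exp (-y ^ 2) := by gcongr
    _ = Real.exp (y - 1 + -y ^ 2) := (Real.exp_add _ _).symm
    _ ≤ Real.exp (-s ^ 2) := Real.exp_le_exp.mpr (by nlinarith)

/-- A distance `x ≥ σ * (1 + √(log (2σ/r)))` has weight at most `r / (2σ)`. -/
lemma weight_le_of_far {σ r x : ℝ} (hσ : 0 < σ) (hr : 0 < r) (hr2 : r ≤ 2 * σ)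
    (hx : σ * (1 + Real.sqrt (Real.log (2 * σ / r))) ≤ x) :
    (x / σ) * Real.exp (-(x ^ 2) / σ ^ 2) ≤ r / (2 * σ) := by
  have hlog : 0 ≤ Real.log (2 * σ / r) := Real.log_nonneg ((one_le_div hr).mpr hr2)
  have h := mul_exp_neg_sq_le_exp_neg_sq (Real.sqrt_nonneg _) ((le_div_iff₀' hσ).mpr hx)
  rwa [Real.sq_sqrt hlog, Real.exp_neg (Real.log _), Real.exp_log (by positivity), inv_div,
    div_pow, ← neg_div] at h

open Metric in
/-- If the landmark `q` is far enough from both sets, namely at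
distance at least `σ·(1 + √(ln(2σ/r)))` with `0 < r ≤ 2σ`, then the sum of the weighted
feature magnitudes is at most `r/σ`. -/
theorem weight_sum_le_of_far
    (σ : ℝ) (hσ : 0 < σ) (r : ℝ) (hr : 0 < r) (hr2 : r ≤ 2 * σ)
    (A B : Set (EuclideanSpace ℝ (Fin 2))) (hA : A.Nonempty) (hB : B.Nonempty)
    (q : EuclideanSpace ℝ (Fin 2))
    (hqA : σ * (1 + Real.sqrt (Real.log (2 * σ / r))) ≤ infDist q A)
    (hqB : σ * (1 + Real.sqrt (Real.log (2 * σ / r))) ≤ infDist q B) :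
    (infDist q A / σ) * Real.exp (-(infDist q A ^ 2) / σ ^ 2)
      + (infDist q B / σ) * Real.exp (-(infDist q B ^ 2) / σ ^ 2)
      ≤ r / σ := by
  have hsplit : r / σ = r / (2 * σ) + r / (2 * σ) := by field_simp; norm_num
  rw [hsplit]
  exact add_le_add (weight_le_of_far hσ hr hr2 hqA) (weight_le_of_far hσ hr hr2 hqB)
end

section
/- Let K and K′ be compact convex subsets of ℝ², each with nonempty interior, and let q be a point with q ∈ K′ and q ∉ K. Then d(q, ∂K) + d(q, ∂K′) ≤ d_H(∂K, ∂K′), where ∂S denotes the topological boundary (frontier) of S, d(q, S) = inf_{p ∈ S} ‖q − p‖, and d_H is the Hausdorff distance. -/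
/-- If `p + t • u` lies in the interior of `S`, then `S` contains a point of the ray that is
strictly further along `u`. -/
theorem exists_lt_add_smul_mem_of_mem_interior {E : Type*} [NormedAddCommGroup E]
    [NormedSpace ℝ E] {S : Set E} {p u : E} {t : ℝ} (h : p + t • u ∈ interior S) :
    ∃ s, t < s ∧ p + s • u ∈ S := by
  have hcont : Continuous fun s : ℝ => p + s • u := by fun_prop
  have hev : ∀ᶠ s in nhds t, p + s • u ∈ S :=
    hcont.continuousAt.eventually (mem_interior_iff_mem_nhds.mp h)
  obtain ⟨s, hs, hts⟩ :=
    ((hev.filter_mono nhdsWithin_le_nhds).and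
      (self_mem_nhdsWithin : Set.Ioi t ∈ nhdsWithin t (Set.Ioi t))).exists
  exact ⟨s, hts, hs⟩

/-- A ray that meets a compact set at parameter `a` leaves it through a frontier point. -/
theorem IsCompact.exists_add_smul_mem_frontier {E : Type*} [NormedAddCommGroup E]
    [NormedSpace ℝ E] {S : Set E} (hS : IsCompact S) {p u : E} (hu : u ≠ 0) {a : ℝ}
    (ha : p + a • u ∈ S) : ∃ t, a ≤ t ∧ p + t • u ∈ frontier S := by
  have hcont : Continuous fun s : ℝ => p + s • u := by fun_prop
  obtain ⟨R, hR⟩ := hS.isBounded.exists_norm_le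
  have hu' : 0 < ‖u‖ := norm_pos_iff.mpr hu
  set T : Set ℝ := {s | a ≤ s ∧ p + s • u ∈ S}
  have hclosed : IsClosed T := isClosed_Ici.inter (hS.isClosed.preimage hcont)
  have hbdd : BddAbove T := by
    refine ⟨(R + ‖p‖) / ‖u‖, fun s hs => ?_⟩
    rw [le_div_iff₀ hu']
    calc s * ‖u‖ ≤ ‖s • u‖ := by
          rw [norm_smul]
          exact mul_le_mul_of_nonneg_right (le_abs_self s) hu'.le
      _ = ‖(p + s • u) - p‖ := by rw [add_sub_cancel_left]
      _ ≤ ‖p + s • u‖ + ‖p‖ := norm_sub_le _ _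
      _ ≤ R + ‖p‖ := by gcongr; exact hR _ hs.2
  have hmem : sSup T ∈ T := hclosed.csSup_mem ⟨a, le_rfl, ha⟩ hbdd
  refine ⟨sSup T, hmem.1, subset_closure hmem.2, fun hint => ?_⟩
  obtain ⟨s, hts, hs⟩ := exists_lt_add_smul_mem_of_mem_interior hint
  exact absurd (le_csSup hbdd ⟨hmem.1.trans hts.le, hs⟩) hts.not_ge

/-- A point outside a nonempty compact convex set has a nearest point on the frontier,
together with the associated supporting half-space. -/
theorem Convex.exists_mem_frontier_forall_inner_le_zero {E : Type*} [NormedAddCommGroup E]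
    [InnerProductSpace ℝ E] {K : Set E} (hconv : Convex ℝ K) (hcomp : IsCompact K)
    (hne : K.Nonempty) {q : E} (hq : q ∉ K) :
    ∃ p ∈ frontier K, ∀ w ∈ K, inner ℝ (q - p) (w - p) ≤ 0 := by
  obtain ⟨p, hp, hmin⟩ := exists_norm_eq_iInf_of_complete_convex hne hcomp.isComplete hconv q
  have hinner := (norm_eq_iInf_iff_real_inner_le_zero hconv hp).mp hmin
  refine ⟨p, ⟨subset_closure hp, fun hint => ?_⟩, hinner⟩
  obtain ⟨s, hs, hsK⟩ : ∃ s : ℝ, 0 < s ∧ p + s • (q - p) ∈ K :=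
    exists_lt_add_smul_mem_of_mem_interior (by simpa using hint)
  have hle := hinner _ hsK
  rw [add_sub_cancel_left, real_inner_smul_right] at hle
  have hpos : 0 < inner ℝ (q - p) (q - p) :=
    real_inner_self_pos.mpr (sub_ne_zero.mpr fun h => hq (h ▸ hp))
  exact (mul_pos hs hpos).not_ge hle

open Metric in
/-- For compact convex bodies `K`, `K'` in the plane (each with
nonempty interior) and a point `q ∈ K' \ K`, the sum of the distances from `q` to the
two boundaries is at most the Hausdorff distance between the boundaries. -/
theorem infDist_frontier_sum_le_hausdorffDist
    (K K' : Set (EuclideanSpace ℝ (Fin 2)))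
    (hKconv : Convex ℝ K) (hKcomp : IsCompact K) (hKint : (interior K).Nonempty)
    (hK'conv : Convex ℝ K') (hK'comp : IsCompact K') (hK'int : (interior K').Nonempty)
    (q : EuclideanSpace ℝ (Fin 2)) (hq' : q ∈ K') (hq : q ∉ K) :
    infDist q (frontier K) + infDist q (frontier K')
      ≤ hausdorffDist (frontier K) (frontier K') := by
  obtain ⟨p, hp, hinner⟩ := hKconv.exists_mem_frontier_forall_inner_le_zero hKcomp
    (hKint.mono interior_subset) hq
  have hKfr : frontier K ⊆ K := hKcomp.isClosed.frontier_subset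
  have hK'fr : frontier K' ⊆ K' := hK'comp.isClosed.frontier_subset
  set u := q - p with hu
  have hq_eq : q = p + (1 : ℝ) • u := by simp [hu]
  have hu0 : u ≠ 0 := sub_ne_zero.mpr fun h => hq (h ▸ hKfr hp)
  have hu' : 0 < ‖u‖ := norm_pos_iff.mpr hu0
  obtain ⟨t, ht, hx⟩ := hK'comp.exists_add_smul_mem_frontier hu0 (hq_eq ▸ hq')
  have hdK : infDist q (frontier K) ≤ ‖u‖ := by
    simpa [dist_eq_norm, hu] using infDist_le_dist_of_mem (x := q) hp
  have hdK' : infDist q (frontier K') ≤ (t - 1) * ‖u‖ := by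
    refine (infDist_le_dist_of_mem hx).trans_eq ?_
    rw [dist_comm, dist_eq_norm]
    have hsub : p + t • u - q = (t - 1) • u := by
      rw [hu]; module
    rw [hsub, norm_smul, Real.norm_of_nonneg (sub_nonneg.mpr ht)]
  have hfar : t * ‖u‖ ≤ infDist (p + t • u) (frontier K) := by
    refine (le_infDist ⟨p, hp⟩).mpr fun w hw => ?_
    rw [dist_eq_norm]
    refine le_of_mul_le_mul_left ?_ hu'
    calc ‖u‖ * (t * ‖u‖) = inner ℝ u (t • u) := by
          rw [real_inner_smul_right, real_inner_self_eq_norm_sq]; ring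
      _ ≤ inner ℝ u (t • u) - inner ℝ u (w - p) := by linarith [hinner w (hKfr hw)]
      _ = inner ℝ u (p + t • u - w) := by
          rw [← inner_sub_right]; congr 1; abel
      _ ≤ ‖u‖ * ‖p + t • u - w‖ := real_inner_le_norm _ _
  have hfin : hausdorffEDist (frontier K') (frontier K) ≠ ⊤ :=
    hausdorffEDist_ne_top_of_nonempty_of_bounded ⟨_, hx⟩ ⟨p, hp⟩
      (hK'comp.isBounded.subset hK'fr) (hKcomp.isBounded.subset hKfr)
  calc infDist q (frontier K) + infDist q (frontier K') ≤ t * ‖u‖ := by linarith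
    _ ≤ infDist (p + t • u) (frontier K) := hfar
    _ ≤ hausdorffDist (frontier K') (frontier K) := infDist_le_hausdorffDist_of_mem hx hfin
    _ = hausdorffDist (frontier K) (frontier K') := hausdorffDist_comm
end
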